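/- arXiv:1906.04807 — 2 statements merged into one kernel-verified Lean document; each statement's English description precedes it below -/
import Mathlib

section
/- Let ρ, β_1, ..., β_r be multilinear forms as in the one-sided regularity hypothesis (with |E_x χ(ρ(x) − Σ_{i∈I}λ_iβ_i(x))| ≤ f^{−4(k+1)(r+1)} for all λ). Let x, y ∈ G_1 × ... × G_k satisfy ρ(x), ρ(y) ≠ 0 and β_i(x_{I_i}) = β_i(y_{I_i}) = 0 for all i. Then there exist points q^0, q^1, ..., q^s with: (1) consecutive points differ in exactly one coordinate; (2) q^0 = x and q^s = (λ_1 y_1, ..., λ_k y_k) for some nonzero scalars λ_1,...,λ_k; (3) s ≤ (2k+1)(2^k − 1); (4) ρ(q^0) = ρ(q^1) = ... = ρ(q^s) and β_j(q^i_{I_j}) = 0 for all i ∈ [0,s], j ∈ [r]. -/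
open scoped BigOperators

/-- `β` depends only on the coordinates in `I`, and is linear in each coordinate of `I`. -/
def MultilinearOn (F : Type*) [Field F] {k : ℕ} {G : Fin k → Type*}
    [∀ i, AddCommGroup (G i)] [∀ i, Module F (G i)]
    {M : Type*} [AddCommGroup M] [Module F M]
    (I : Finset (Fin k)) (β : (∀ i, G i) → M) : Prop :=
  (∀ x y : ∀ i, G i, (∀ i ∈ I, x i = y i) → β x = β y) ∧
  (∀ i ∈ I, ∀ (x : ∀ j, G j) (v w : G i),
      β (Function.update x i (v + w))
        = β (Function.update x i v) + β (Function.update x i w)) ∧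
  (∀ i ∈ I, ∀ (x : ∀ j, G j) (c : F) (v : G i),
      β (Function.update x i (c • v)) = c • β (Function.update x i v))

/-- The expectation `E_x χ(α(x))` over uniformly random `x`. -/
noncomputable def expChar {k : ℕ} {F : Type*} [Field F] {G : Fin k → Type*}
    [∀ i, AddCommGroup (G i)] [∀ i, Module F (G i)] [∀ i, Fintype (G i)]
    (χ : AddChar F ℂ) (α : (∀ i, G i) → F) : ℂ :=
  (∑ x : ∀ i, G i, χ (α x)) / (Fintype.card (∀ i, G i) : ℂ)

namespace LP

set_option linter.unusedSectionVars false

open Function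

section Alg

variable {k : ℕ} {F : Type*} [Field F] {G : Fin k → Type*}
  [∀ i, AddCommGroup (G i)] [∀ i, Module F (G i)]

open Classical in
/-- The linear functional obtained by freezing all coordinates but `d` (zero if `d ∉ I`). -/
noncomputable def slice {I : Finset (Fin k)} {β : (∀ i, G i) → F} (h : MultilinearOn F I β)
    (d : Fin k) (u : ∀ i, G i) : G d →ₗ[F] F :=
  if hd : d ∈ I then
    { toFun := fun t => β (update u d t)
      map_add' := h.2.1 d hd u
      map_smul' := h.2.2 d hd u }
  else 0

lemma slice_mem {I : Finset (Fin k)} {β : (∀ i, G i) → F} (h : MultilinearOn F I β)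
    {d : Fin k} (hd : d ∈ I) (u : ∀ i, G i) (t : G d) :
    slice h d u t = β (update u d t) := by
  simp [slice, hd]

lemma slice_not_mem {I : Finset (Fin k)} {β : (∀ i, G i) → F} (h : MultilinearOn F I β)
    {d : Fin k} (hd : d ∉ I) (u : ∀ i, G i) : slice h d u = 0 := by
  simp [slice, hd]

lemma update_not_mem {I : Finset (Fin k)} {β : (∀ i, G i) → F} (h : MultilinearOn F I β)
    {d : Fin k} (hd : d ∉ I) (u : ∀ i, G i) (t : G d) : β (update u d t) = β u := by
  apply h.1
  intro i hi
  have : i ≠ d := fun e => hd (e ▸ hi)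
  simp [this]

lemma slice_eq {I : Finset (Fin k)} {β : (∀ i, G i) → F} (h : MultilinearOn F I β)
    (d : Fin k) (u : ∀ i, G i) (t : G d) (hu : β u = 0) :
    slice h d u t = β (update u d t) := by
  by_cases hd : d ∈ I
  · exact slice_mem h hd u t
  · rw [slice_not_mem h hd, update_not_mem h hd, hu]; rfl

/-- `(b_0,…,b_{j-1},z_j,…)` -/
def mix (j : ℕ) (b z : ∀ i, G i) : ∀ i, G i := fun i => if i.val < j then b i else z i

lemma mix_zero (b z : ∀ i, G i) : mix 0 b z = z := by
  funext i; simp [mix]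

lemma mix_k (b z : ∀ i, G i) : mix k b z = b := by
  funext i; simp [mix]

lemma mix_succ_update (d : Fin k) (b z : ∀ i, G i) (t : G d) :
    mix (d.val + 1) (update b d t) z = update (mix d.val b z) d t := by
  funext i
  by_cases h : i = d
  · subst h; simp [mix]
  · have : i.val ≠ d.val := fun e => h (Fin.ext e)
    simp only [mix, update_of_ne h]
    by_cases h2 : i.val < d.val
    · simp [h2, Nat.lt_succ_of_lt h2]
    · have : ¬ i.val < d.val + 1 := by omega
      simp [h2, this]

lemma mix_update_of_le (d : Fin k) (j : ℕ) (hj : j ≤ d.val) (b z : ∀ i, G i) (t : G d) :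
    mix j (update b d t) z = mix j b z := by
  funext i
  by_cases h : i = d
  · subst h
    have : ¬ i.val < j := by omega
    simp [mix, this]
  · simp [mix, update_of_ne h]

lemma mix_update_right (d : Fin k) (x z : ∀ i, G i) (t : G d) :
    mix d.val x (update z d t) = update (mix (d.val + 1) x z) d t := by
  funext i
  by_cases h : i = d
  · subst h; simp [mix]
  · have : i.val ≠ d.val := fun e => h (Fin.ext e)
    simp only [mix, update_of_ne h]
    by_cases h2 : i.val < d.val
    · simp [h2, Nat.lt_succ_of_lt h2]
    · have : ¬ i.val < d.val + 1 := by omega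
      simp [h2, this]

lemma mix_update_right_of_lt (d : Fin k) (j : ℕ) (hj : d.val < j) (x z : ∀ i, G i) (t : G d) :
    mix j x (update z d t) = mix j x z := by
  funext i
  by_cases h : i = d
  · subst h; simp [mix, hj]
  · simp [mix, update_of_ne h]

lemma mix_mix (j : ℕ) (b z w : ∀ i, G i) : mix j (mix j b z) w = mix j b w := by
  funext i
  by_cases h : i.val < j <;> simp [mix, h]

lemma mix_multilinear {I : Finset (Fin k)} {β : (∀ i, G i) → F} (h : MultilinearOn F I β)
    (j : ℕ) (w : ∀ i, G i) :
    MultilinearOn F (I.filter (fun i => i.val < j)) (fun u => β (mix j u w)) := by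
  have key : ∀ (i : Fin k), i.val < j → ∀ (x : ∀ i, G i) (v : G i),
      mix j (update x i v) w = update (mix j x w) i v := by
    intro i hi x v
    funext m
    by_cases hm : m = i
    · subst hm; simp [mix, hi]
    · simp [mix, update_of_ne hm]
  refine ⟨?_, ?_, ?_⟩
  · intro x y hxy
    apply h.1
    intro i hi
    by_cases hj : i.val < j
    · simpa [mix, hj] using hxy i (by simp [hi, hj])
    · simp [mix, hj]
  · intro i hi x v v'
    simp only [Finset.mem_filter] at hi
    simp only [key i hi.2]
    exact h.2.1 i hi.1 _ v v'
  · intro i hi x v v'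
    simp only [Finset.mem_filter] at hi
    simp only [key i hi.2]
    exact h.2.2 i hi.1 _ v v'

lemma const_mul_multilinear {I : Finset (Fin k)} {β : (∀ i, G i) → F}
    (h : MultilinearOn F I β) (c : F) : MultilinearOn F I (fun u => c * β u) := by
  refine ⟨?_, ?_, ?_⟩
  · intro x y hxy
    simp only [h.1 x y hxy]
  · intro i hi x v w
    simp only [h.2.1 i hi x v w, mul_add]
  · intro i hi x v w
    simp only [h.2.2 i hi x v w, smul_eq_mul]; ring

lemma scale_multilinear {I : Finset (Fin k)} {β : (∀ i, G i) → F}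
    (h : MultilinearOn F I β) (lam : Fin k → F) (v : ∀ i, G i) :
    β (fun i => lam i • v i) = (∏ i ∈ I, lam i) * β v := by
  have key : ∀ J : Finset (Fin k), J ⊆ I →
      β (fun i => if i ∈ J then lam i • v i else v i) = (∏ i ∈ J, lam i) * β v := by
    intro J
    induction J using Finset.induction_on with
    | empty => intro _; simp
    | insert a J ha ih =>
      intro hJ
      have haI : a ∈ I := hJ (Finset.mem_insert_self a J)
      have e1 : (fun i => if i ∈ insert a J then lam i • v i else v i)
          = update (fun i => if i ∈ J then lam i • v i else v i) a (lam a • v a) := by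
        funext i
        by_cases hi : i = a
        · subst hi; simp
        · simp [hi]
      have e2 : update (fun i => if i ∈ J then lam i • v i else v i) a (v a)
          = (fun i => if i ∈ J then lam i • v i else v i) := by
        funext i
        by_cases hi : i = a
        · subst hi; simp [ha]
        · simp [hi]
      rw [e1, h.2.2 a haI, e2, ih (fun i hi => hJ (Finset.mem_insert_of_mem hi)),
        Finset.prod_insert ha, smul_eq_mul, mul_assoc]
  rw [← key I (Finset.Subset.refl _)]
  apply h.1
  intro i hi
  simp [hi]

/-- The set `ρ ≠ 0`, all `β_j = 0`. -/
def S {r : ℕ} (ρ : (∀ i, G i) → F) (β : Fin r → (∀ i, G i) → F) (v : ∀ i, G i) : Prop :=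
  ρ v ≠ 0 ∧ ∀ j, β j v = 0

/-- The conclusion of the theorem, with length at most `n`. -/
def L {r : ℕ} (ρ : (∀ i, G i) → F) (β : Fin r → (∀ i, G i) → F) (x : ∀ i, G i) (n : ℕ)
    (y : ∀ i, G i) : Prop :=
  ∃ (s : ℕ) (q : ℕ → ∀ i, G i) (lam : Fin k → F),
      s ≤ n ∧
      (∀ t < s, ∃ d : Fin k, q t d ≠ q (t + 1) d ∧ ∀ i ≠ d, q t i = q (t + 1) i) ∧
      q 0 = x ∧ (∀ i, lam i ≠ 0) ∧ q s = (fun i => lam i • y i) ∧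
      (∀ t ≤ s, ρ (q t) = ρ x) ∧ (∀ t ≤ s, ∀ j, β j (q t) = 0)

lemma L_zero {r : ℕ} {ρ : (∀ i, G i) → F} {β : Fin r → (∀ i, G i) → F} {x : ∀ i, G i}
    (hx : S ρ β x) : L ρ β x 0 x := by
  refine ⟨0, fun _ => x, fun _ => 1, le_rfl, by simp, rfl, by simp, by simp, by simp, ?_⟩
  intro t _ j
  exact hx.2 j

lemma L_step {r : ℕ} {ρ : (∀ i, G i) → F} (hρ : MultilinearOn F Finset.univ ρ)
    {β : Fin r → (∀ i, G i) → F} {βI : Fin r → Finset (Fin k)}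
    (hβ : ∀ j, MultilinearOn F (βI j) (β j)) {x v v' : ∀ i, G i} {n : ℕ} (hx : ρ x ≠ 0)
    (hL : L ρ β x n v) (hv' : S ρ β v') (d : Fin k) (hd : ∀ i ≠ d, v i = v' i) :
    L ρ β x (n + 1) v' := by
  obtain ⟨s, q, lam, hs, hstep, h0, hlam, hqs, hρq, hβq⟩ := hL
  set P := ∏ i ∈ Finset.univ.erase d, lam i with hP
  have hP0 : P ≠ 0 := Finset.prod_ne_zero_iff.mpr fun i _ => hlam i
  set μ : F := ρ x / (P * ρ v') with hμ
  have hμ0 : μ ≠ 0 := div_ne_zero hx (mul_ne_zero hP0 hv'.1)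
  set lam' : Fin k → F := update lam d μ with hlam'
  have hprod : ∏ i, lam' i = μ * P := by
    rw [← Finset.mul_prod_erase Finset.univ lam' (Finset.mem_univ d)]
    congr 1
    · simp [hlam']
    · apply Finset.prod_congr rfl
      intro i hi
      simp [hlam', Finset.ne_of_mem_erase hi]
  have hl0 : ∀ i, lam' i ≠ 0 := by
    intro i
    by_cases hi : i = d
    · subst hi; simpa [hlam'] using hμ0
    · simpa [hlam', hi] using hlam i
  set z : ∀ i, G i := fun i => lam' i • v' i with hz
  have hρz : ρ z = ρ x := by
    rw [hz, scale_multilinear hρ, hprod, hμ]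
    have := hv'.1
    field_simp
  have hβz : ∀ j, β j z = 0 := by
    intro j
    rw [hz, scale_multilinear (hβ j), hv'.2 j, mul_zero]
  have hagree : ∀ i ≠ d, q s i = z i := by
    intro i hi
    rw [hqs, hz]
    simp [hlam', hi, hd i hi]
  by_cases hsame : q s d = z d
  · refine ⟨s, q, lam', by omega, hstep, h0, hl0, ?_, hρq, hβq⟩
    funext i
    by_cases hi : i = d
    · subst hi; exact hsame
    · exact hagree i hi
  · refine ⟨s + 1, fun t => if t ≤ s then q t else z, lam', by omega, ?_, by simp [h0], hl0,
      by simp [hz], ?_, ?_⟩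
    · intro t ht
      by_cases hts : t = s
      · subst hts
        refine ⟨d, ?_, ?_⟩
        · simpa using hsame
        · intro i hi; simpa using hagree i hi
      · have h1 : t < s := by omega
        obtain ⟨e, he⟩ := hstep t h1
        refine ⟨e, ?_⟩
        have h2 : t ≤ s := by omega
        have h3 : t + 1 ≤ s := by omega
        simpa [h2, h3] using he
    · intro t ht
      by_cases hts : t ≤ s
      · simpa [hts] using hρq t hts
      · simpa [hts] using hρz
    · intro t ht
      by_cases hts : t ≤ s
      · simpa [hts] using hβq t hts
      · simpa [hts] using hβz

lemma mix_adj (b z : ∀ i, G i) (d : Fin k) : ∀ i ≠ d, mix d.val b z i = mix (d.val + 1) b z i := by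
  intro i hi
  have : i.val ≠ d.val := fun e => hi (Fin.ext e)
  simp only [mix]
  by_cases h2 : i.val < d.val
  · simp [h2, Nat.lt_succ_of_lt h2]
  · have : ¬ i.val < d.val + 1 := by omega
    simp [h2, this]

lemma L_up {r : ℕ} {ρ : (∀ i, G i) → F} (hρ : MultilinearOn F Finset.univ ρ)
    {β : Fin r → (∀ i, G i) → F} {βI : Fin r → Finset (Fin k)}
    (hβ : ∀ j, MultilinearOn F (βI j) (β j)) {x b z : ∀ i, G i} {n : ℕ} (hx : ρ x ≠ 0)
    (hL : L ρ β x n z) (h : ∀ j ≤ k, S ρ β (mix j b z)) : L ρ β x (n + k) b := by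
  have key : ∀ j ≤ k, L ρ β x (n + j) (mix j b z) := by
    intro j
    induction j with
    | zero => intro _; simpa [mix_zero] using hL
    | succ j ih =>
      intro hj
      exact L_step hρ hβ hx (ih (by omega)) (h (j + 1) hj) ⟨j, by omega⟩
        (mix_adj b z ⟨j, by omega⟩)
  simpa [mix_k] using key k le_rfl

lemma L_down {r : ℕ} {ρ : (∀ i, G i) → F} (hρ : MultilinearOn F Finset.univ ρ)
    {β : Fin r → (∀ i, G i) → F} {βI : Fin r → Finset (Fin k)}
    (hβ : ∀ j, MultilinearOn F (βI j) (β j)) {x b z : ∀ i, G i} {n : ℕ} (hx : ρ x ≠ 0)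
    (hL : L ρ β x n b) (h : ∀ j ≤ k, S ρ β (mix j b z)) : L ρ β x (n + k) z := by
  have key : ∀ m j, j + m = k → L ρ β x (n + m) (mix j b z) := by
    intro m
    induction m with
    | zero => intro j hj; simp only [add_zero] at hj; subst hj; simpa [mix_k] using hL
    | succ m ih =>
      intro j hj
      refine L_step hρ hβ hx (ih (j + 1) (by omega)) (h j (by omega)) ⟨j, by omega⟩ ?_
      intro i hi
      exact (mix_adj b z ⟨j, by omega⟩ i hi).symm
  simpa [mix_zero] using key k 0 (by omega)

end Alg

section Count

open Classical in
/-- Real-valued indicator. -/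
noncomputable def ind (p : Prop) : ℝ := if p then 1 else 0

lemma ind_nonneg (p : Prop) : 0 ≤ ind p := by
  unfold ind; split_ifs <;> norm_num

lemma ind_true {p : Prop} (h : p) : ind p = 1 := by simp [ind, h]

lemma ind_false {p : Prop} (h : ¬ p) : ind p = 0 := by simp [ind, h]

lemma ind_mono {p q : Prop} (h : p → q) : ind p ≤ ind q := by
  by_cases hp : p
  · rw [ind_true hp, ind_true (h hp)]
  · rw [ind_false hp]; exact ind_nonneg q

variable {k : ℕ} {F : Type*} [Field F] [Fintype F] {G : Fin k → Type*}
  [∀ i, AddCommGroup (G i)] [∀ i, Module F (G i)] [∀ i, Fintype (G i)]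

lemma sum_update {M : Type*} [AddCommMonoid M] (d : Fin k) (g : (∀ i, G i) → M) :
    ∑ u : ∀ i, G i, ∑ t : G d, g (update u d t) = Fintype.card (G d) • ∑ u : ∀ i, G i, g u := by
  rw [← Fintype.sum_prod_type']
  have : ∑ p : (∀ i, G i) × G d, g (update p.1 d p.2) = ∑ p : (∀ i, G i) × G d, g p.1 := by
    let e : ((∀ i, G i) × G d) ≃ ((∀ i, G i) × G d) :=
      { toFun := fun p => (update p.1 d p.2, p.1 d)
        invFun := fun p => (update p.1 d p.2, p.1 d)
        left_inv := by intro p; simp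
        right_inv := by intro p; simp }
    exact Fintype.sum_equiv e _ _ (fun p => rfl)
  rw [this, Fintype.sum_prod_type]
  simp [Finset.smul_sum]

lemma sum_mix {M : Type*} [AddCommMonoid M] (j : ℕ) (g : (∀ i, G i) → M) :
    ∑ z : ∀ i, G i, ∑ b : ∀ i, G i, g (mix j b z)
      = Fintype.card (∀ i, G i) • ∑ u : ∀ i, G i, g u := by
  rw [← Fintype.sum_prod_type']
  have : ∑ p : (∀ i, G i) × (∀ i, G i), g (mix j p.2 p.1)
      = ∑ p : (∀ i, G i) × (∀ i, G i), g p.1 := by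
    have hinv : ∀ b z : ∀ i, G i, mix j (mix j z b) (mix j b z) = z := by
      intro b z; funext i; by_cases h : i.val < j <;> simp [mix, h]
    have hinv' : ∀ b z : ∀ i, G i, mix j (mix j b z) (mix j z b) = b := by
      intro b z; funext i; by_cases h : i.val < j <;> simp [mix, h]
    let e : ((∀ i, G i) × (∀ i, G i)) ≃ ((∀ i, G i) × (∀ i, G i)) :=
      { toFun := fun p => (mix j p.2 p.1, mix j p.1 p.2)
        invFun := fun p => (mix j p.2 p.1, mix j p.1 p.2)
        left_inv := by intro p; ext1 <;> simp [hinv]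
        right_inv := by intro p; ext1 <;> simp [hinv] }
    exact Fintype.sum_equiv e _ _ (fun p => rfl)
  rw [this, Fintype.sum_prod_type]
  simp [Finset.smul_sum]

lemma fiber (d : Fin k) (P Q : (∀ i, G i) → Prop) (C : ℝ)
    (h : ∀ u, P u → (Fintype.card (G d) : ℝ) ≤ C * ∑ t : G d, ind (Q (update u d t)))
    (hC : 0 ≤ C) :
    ∑ u, ind (P u) ≤ C * ∑ u, ind (Q u) := by
  have hpos : (0 : ℝ) < Fintype.card (G d) := by
    exact_mod_cast Fintype.card_pos_iff.mpr ⟨0⟩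
  have h1 : (Fintype.card (G d) : ℝ) * ∑ u, ind (P u)
      ≤ (Fintype.card (G d) : ℝ) * (C * ∑ u, ind (Q u)) := by
    have h2 := sum_update d (fun u => ind (Q u))
    rw [nsmul_eq_mul] at h2
    calc (Fintype.card (G d) : ℝ) * ∑ u, ind (P u)
        = ∑ u, (Fintype.card (G d) : ℝ) * ind (P u) := Finset.mul_sum _ _ _
      _ ≤ ∑ u, C * ∑ t : G d, ind (Q (update u d t)) := by
          apply Finset.sum_le_sum
          intro u _
          by_cases hu : P u
          · rw [ind_true hu, mul_one]; exact h u hu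
          · rw [ind_false hu, mul_zero]
            exact mul_nonneg hC (Finset.sum_nonneg fun t _ => ind_nonneg _)
      _ = C * (∑ u, ∑ t : G d, ind (Q (update u d t))) := (Finset.mul_sum _ _ _).symm
      _ = (Fintype.card (G d) : ℝ) * (C * ∑ u, ind (Q u)) := by rw [h2]; ring
  exact le_of_mul_le_mul_left h1 hpos

/-- fibers of a family of functionals are large -/
lemma coset {H : Type*} [AddCommGroup H] [Module F H] [Fintype H] {ι : Type*} [Fintype ι]
    (ℓ : ι → H →ₗ[F] F) (t0 : H) :
    (Fintype.card H : ℝ) ≤ (Fintype.card F : ℝ) ^ (Fintype.card ι) *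
      ∑ t : H, ind (∀ i, ℓ i t = ℓ i t0) := by
  classical
  have h1 : ∀ a : ι → F, ∑ t : H, ind (∀ i, ℓ i t = a i)
      ≤ ∑ t : H, ind (∀ i, ℓ i t = ℓ i t0) := by
    intro a
    by_cases ha : ∃ s, ∀ i, ℓ i s = a i
    · obtain ⟨s, hs⟩ := ha
      apply le_of_eq
      apply Fintype.sum_equiv (Equiv.addRight (t0 - s))
      intro t
      congr 1
      apply propext
      apply forall_congr'
      intro i
      simp only [Equiv.coe_addRight, map_add, map_sub, hs i]
      constructor
      · intro h; rw [h]; ring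
      · intro h; linear_combination h
    · push Not at ha
      rw [Finset.sum_eq_zero]
      · exact Finset.sum_nonneg fun t _ => ind_nonneg _
      · intro t _
        obtain ⟨i, hi⟩ := ha t
        exact ind_false fun h => hi (h i)
  have h2 : (Fintype.card H : ℝ) = ∑ a : ι → F, ∑ t : H, ind (∀ i, ℓ i t = a i) := by
    rw [Finset.sum_comm]
    have : ∀ t : H, ∑ a : ι → F, ind (∀ i, ℓ i t = a i) = 1 := by
      intro t
      rw [Finset.sum_eq_single (fun i => ℓ i t)]
      · exact ind_true fun i => rfl
      · intro a _ ha
        exact ind_false fun h => ha (funext fun i => (h i).symm)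
      · simp
    simp [this]
  rw [h2]
  calc _ ≤ ∑ a : ι → F, ∑ t : H, ind (∀ i, ℓ i t = ℓ i t0) := Finset.sum_le_sum fun a _ => h1 a
    _ = _ := by simp

/-- character sum of a linear functional -/
lemma char_lin {H : Type*} [AddCommGroup H] [Module F H] [Fintype H]
    (χ : AddChar F ℂ) (hχ : χ ≠ 1) (ℓ : H →ₗ[F] F) :
    ∑ t : H, χ (ℓ t) = (Fintype.card H : ℂ) * ((ind (ℓ = 0) : ℝ) : ℂ) := by
  by_cases h : ℓ = 0
  · rw [ind_true h]; subst h; simp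
  · rw [ind_false h]
    have hs : Function.Surjective ℓ := LinearMap.surjective h
    have hne : χ.compAddMonoidHom ℓ.toAddMonoidHom ≠ 1 := by
      intro he
      apply hχ
      ext a
      obtain ⟨t, rfl⟩ := hs a
      have := DFunLike.congr_fun he t
      simpa using this
    have := AddChar.sum_eq_zero_of_ne_one hne
    simpa using this

lemma char_slice (χ : AddChar F ℂ) (hχ : χ ≠ 1) (d : Fin k) (R Φ : (∀ i, G i) → F)
    (hR : ∀ u t, R (update u d t) = R u) (ℓ : (∀ i, G i) → G d →ₗ[F] F)
    (hℓ : ∀ u t, Φ (update u d t) = ℓ u t) :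
    ∑ u, χ (R u + Φ u) = ∑ u, χ (R u) * ((ind (ℓ u = 0) : ℝ) : ℂ) := by
  have hpos : (Fintype.card (G d) : ℂ) ≠ 0 := by
    exact_mod_cast (Fintype.card_pos_iff.mpr ⟨(0 : G d)⟩).ne'
  apply mul_left_cancel₀ hpos
  have h2 := sum_update d (fun u => χ (R u + Φ u))
  rw [nsmul_eq_mul] at h2
  rw [← h2, Finset.mul_sum]
  apply Finset.sum_congr rfl
  intro u _
  simp only [hR, hℓ, AddChar.map_add_eq_mul]
  rw [← Finset.mul_sum, char_lin χ hχ]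
  ring

lemma bias_filter {ι : Type*} [DecidableEq ι] (χ : AddChar F ℂ) (hχ : χ ≠ 1)
    (I : ι → Finset (Fin k)) (β : ι → (∀ i, G i) → F)
    (h : ∀ m, MultilinearOn F (I m) (β m)) (s : Finset ι) (d : Fin k) :
    ‖∑ u, χ (∑ m ∈ s, β m u)‖ ≤ ‖∑ u, χ (∑ m ∈ s.filter (fun m => d ∈ I m), β m u)‖ := by
  set R : (∀ i, G i) → F := fun u => ∑ m ∈ s.filter (fun m => ¬ d ∈ I m), β m u with hRdef
  set Φ : (∀ i, G i) → F := fun u => ∑ m ∈ s.filter (fun m => d ∈ I m), β m u with hΦdef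
  set ℓ : (∀ i, G i) → G d →ₗ[F] F :=
    fun u => ∑ m ∈ s.filter (fun m => d ∈ I m), slice (h m) d u with hℓdef
  have hR : ∀ u t, R (update u d t) = R u := by
    intro u t
    apply Finset.sum_congr rfl
    intro m hm
    exact update_not_mem (h m) (Finset.mem_filter.mp hm).2 u t
  have hℓ : ∀ u t, Φ (update u d t) = ℓ u t := by
    intro u t
    simp only [hΦdef, hℓdef, LinearMap.sum_apply]
    apply Finset.sum_congr rfl
    intro m hm
    exact (slice_mem (h m) (Finset.mem_filter.mp hm).2 u t).symm
  have e1 : ∑ u, χ (∑ m ∈ s, β m u) = ∑ u, χ (R u + Φ u) := by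
    apply Finset.sum_congr rfl
    intro u _
    congr 1
    rw [add_comm]
    exact (Finset.sum_filter_add_sum_filter_not s _ _).symm
  have e2 := char_slice χ hχ d R Φ hR ℓ hℓ
  have e3 := char_slice χ hχ d (fun _ => 0) Φ (fun _ _ => rfl) ℓ hℓ
  simp only [zero_add, AddChar.map_zero_eq_one, one_mul] at e3
  rw [e1, e2, e3]
  have e4 : ‖∑ u, ((ind (ℓ u = 0) : ℝ) : ℂ)‖ = ∑ u, ind (ℓ u = 0) := by
    rw [← Complex.ofReal_sum, Complex.norm_real, Real.norm_of_nonneg]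
    exact Finset.sum_nonneg fun u _ => ind_nonneg _
  rw [e4]
  refine (norm_sum_le _ _).trans (Finset.sum_le_sum fun u _ => ?_)
  rw [norm_mul, Complex.norm_real, Real.norm_of_nonneg (ind_nonneg _), AddChar.norm_apply, one_mul]

lemma bias_full {ι : Type*} [DecidableEq ι] (χ : AddChar F ℂ) (hχ : χ ≠ 1)
    (I : ι → Finset (Fin k)) (β : ι → (∀ i, G i) → F)
    (h : ∀ m, MultilinearOn F (I m) (β m)) (s : Finset ι) :
    ‖∑ u, χ (∑ m ∈ s, β m u)‖
      ≤ ‖∑ u, χ (∑ m ∈ s.filter (fun m => I m = Finset.univ), β m u)‖ := by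
  have key : ∀ D : Finset (Fin k), ‖∑ u, χ (∑ m ∈ s, β m u)‖
      ≤ ‖∑ u, χ (∑ m ∈ s.filter (fun m => D ⊆ I m), β m u)‖ := by
    intro D
    induction D using Finset.induction_on with
    | empty => simp
    | insert a D ha ih =>
      refine ih.trans ((bias_filter χ hχ I β h _ a).trans (le_of_eq ?_))
      congr 1
      apply Finset.sum_congr rfl
      intro u _
      congr 1
      apply Finset.sum_congr _ (fun _ _ => rfl)
      ext m
      simp [Finset.insert_subset_iff]
      tauto
  refine (key Finset.univ).trans (le_of_eq ?_)
  simp only [Finset.univ_subset_iff]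

/-- bad event: `ρ`'s slice is in the span of the slices of the `β`s. -/
def Bad {r : ℕ} {ρ : (∀ i, G i) → F} (hρ : MultilinearOn F Finset.univ ρ)
    {βI : Fin r → Finset (Fin k)} {β : Fin r → (∀ i, G i) → F}
    (hβ : ∀ j, MultilinearOn F (βI j) (β j)) (d : Fin k) (u v : ∀ i, G i)
    (lam lam' : Fin r → F) : Prop :=
  slice hρ d u + ((∑ j, (-lam j) • slice (hβ j) d u) + ∑ j, (-lam' j) • slice (hβ j) d v) = 0

lemma bad_count {r : ℕ} {ρ : (∀ i, G i) → F} (hρ : MultilinearOn F Finset.univ ρ)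
    {βI : Fin r → Finset (Fin k)} {β : Fin r → (∀ i, G i) → F}
    (hβ : ∀ j, MultilinearOn F (βI j) (β j)) (χ : AddChar F ℂ) (hχ : χ ≠ 1) (B : ℝ)
    (hbias : ∀ lam : Fin r → F,
      ‖∑ x, χ (ρ x -
          ∑ j ∈ Finset.univ.filter (fun j => βI j = Finset.univ), lam j * β j x)‖ ≤ B)
    (d : Fin k) (w : ∀ i, G i) (lam lam' : Fin r → F) :
    ∑ u, ind (Bad hρ hβ d u (mix d.val u w) lam lam') ≤ B := by
  classical
  let ι := Option (Fin r ⊕ Fin r)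
  let I : ι → Finset (Fin k) := fun m => match m with
    | none => Finset.univ
    | some (Sum.inl j) => βI j
    | some (Sum.inr j) => (βI j).filter (fun i => i.val < d.val + 1)
  let γ : ι → (∀ i, G i) → F := fun m => match m with
    | none => ρ
    | some (Sum.inl j) => fun u => (-lam j) * β j u
    | some (Sum.inr j) => fun u => (-lam' j) * β j (mix (d.val + 1) u w)
  have hγ : ∀ m, MultilinearOn F (I m) (γ m) := by
    intro m
    match m with
    | none => exact hρ
    | some (Sum.inl j) => exact const_mul_multilinear (hβ j) _
    | some (Sum.inr j) => exact const_mul_multilinear (mix_multilinear (hβ j) _ w) _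
  let Φ : (∀ i, G i) → F := fun u => ∑ m ∈ Finset.univ.filter (fun m => d ∈ I m), γ m u
  have hℓ : ∀ u t, Φ (update u d t) = (slice hρ d u + ((∑ j, (-lam j) • slice (hβ j) d u)
      + ∑ j, (-lam' j) • slice (hβ j) d (mix d.val u w))) t := by
    intro u t
    simp only [Φ, Finset.sum_filter]
    rw [Fintype.sum_option, Fintype.sum_sum_type]
    simp only [LinearMap.add_apply, LinearMap.sum_apply, LinearMap.smul_apply, smul_eq_mul]
    congr 1
    · simp [I, γ, slice_mem hρ (Finset.mem_univ d)]
    · congr 1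
      · apply Finset.sum_congr rfl
        intro j _
        by_cases hd : d ∈ βI j
        · simp [I, γ, hd, slice_mem (hβ j) hd]
        · simp [I, hd, slice_not_mem (hβ j) hd]
      · apply Finset.sum_congr rfl
        intro j _
        by_cases hd : d ∈ βI j
        · simp [I, γ, hd, slice_mem (hβ j) hd, mix_succ_update]
        · simp [I, hd, slice_not_mem (hβ j) hd]
  have e3 := char_slice χ hχ d (fun _ => 0) Φ (fun _ _ => rfl) _ hℓ
  simp only [zero_add, AddChar.map_zero_eq_one, one_mul] at e3
  have e4 : ∑ u, ind (Bad hρ hβ d u (mix d.val u w) lam lam') = ‖∑ u, χ (Φ u)‖ := by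
    rw [e3, ← Complex.ofReal_sum, Complex.norm_real, Real.norm_of_nonneg]
    · rfl
    · exact Finset.sum_nonneg fun u _ => ind_nonneg _
  rw [e4]
  refine (bias_full χ hχ I γ hγ _).trans (le_trans (le_of_eq ?_)
    (hbias (fun j => lam j + if (∀ i : Fin k, i.val < d.val + 1) then lam' j else 0)))
  congr 1
  apply Finset.sum_congr rfl
  intro u _
  congr 1
  have e5 : (Finset.univ.filter (fun m => d ∈ I m)).filter (fun m => I m = Finset.univ)
      = Finset.univ.filter (fun m => I m = Finset.univ) := by
    ext m
    simp only [Finset.mem_filter, Finset.mem_univ, true_and, and_iff_right_iff_imp]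
    intro h; rw [h]; exact Finset.mem_univ d
  rw [e5, Finset.sum_filter, Fintype.sum_option, Fintype.sum_sum_type, ← Finset.sum_add_distrib,
    Finset.sum_filter, sub_eq_add_neg, ← Finset.sum_neg_distrib]
  congr 1
  · simp [I, γ]
  · apply Finset.sum_congr rfl
    intro j _
    have e6 : I (some (Sum.inr j)) = Finset.univ ↔
        (βI j = Finset.univ ∧ ∀ i : Fin k, i.val < d.val + 1) := by
      simp only [I, Finset.eq_univ_iff_forall, Finset.mem_filter]
      exact forall_and
    by_cases h1 : βI j = Finset.univ
    · by_cases h2 : ∀ i : Fin k, i.val < d.val + 1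
      · have e7 : mix (d.val + 1) u w = u := by
          funext i; simp only [mix, if_pos (h2 i)]
        rw [if_pos (e6.mpr ⟨h1, h2⟩), if_pos h1, if_pos h1, if_pos h2]
        simp only [γ, e7]; ring
      · rw [if_neg (fun h => h2 (e6.mp h).2), if_pos h1, if_pos h1, if_neg h2]
        simp only [γ]; ring
    · rw [if_neg (fun h => h1 (e6.mp h).1), if_neg h1, if_neg h1]
      simp

lemma step_one {r : ℕ} {ρ : (∀ i, G i) → F} (hρ : MultilinearOn F Finset.univ ρ)
    {βI : Fin r → Finset (Fin k)} {β : Fin r → (∀ i, G i) → F}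
    (hβ : ∀ j, MultilinearOn F (βI j) (β j)) (d : Fin k) (u : ∀ i, G i) (hu : S ρ β u) :
    (Fintype.card (G d) : ℝ) ≤ (Fintype.card F : ℝ) ^ (r + 1) *
      ∑ t : G d, ind (S ρ β (update u d t)) := by
  let ℓ : Option (Fin r) → G d →ₗ[F] F := fun m => match m with
    | none => slice hρ d u
    | some j => slice (hβ j) d u
  have h := coset ℓ (u d)
  rw [Fintype.card_option, Fintype.card_fin] at h
  refine h.trans (mul_le_mul_of_nonneg_left (Finset.sum_le_sum fun t _ => ind_mono ?_)
    (by positivity))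
  intro ht
  constructor
  · have := ht none
    simp only [ℓ, slice_mem hρ (Finset.mem_univ d), update_eq_self] at this
    rw [this]; exact hu.1
  · intro j
    have := ht (some j)
    simp only [ℓ, slice_eq (hβ j) d u _ (hu.2 j), update_eq_self] at this
    rw [this]; exact hu.2 j

lemma exists_of_not_bad {H : Type*} [AddCommGroup H] [Module F H] {r : ℕ}
    (ℓ : H →ₗ[F] F) (a b : Fin r → H →ₗ[F] F)
    (h : ∀ lam lam' : Fin r → F,
      ¬ (ℓ + ((∑ j, (-lam j) • a j) + ∑ j, (-lam' j) • b j) = 0)) :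
    ∃ t, ℓ t ≠ 0 ∧ (∀ j, a j t = 0) ∧ ∀ j, b j t = 0 := by
  by_contra hcon
  push Not at hcon
  have hm : ℓ ∈ Submodule.span F (Set.range (Sum.elim a b)) := by
    apply mem_span_of_iInf_ker_le_ker
    intro t ht
    simp only [Submodule.mem_iInf, LinearMap.mem_ker] at ht
    rw [LinearMap.mem_ker]
    by_contra h0
    obtain ⟨j, hj⟩ := hcon t h0 (fun j => ht (Sum.inl j))
    exact hj (ht (Sum.inr j))
  obtain ⟨c, hc⟩ := (Submodule.mem_span_range_iff_exists_fun F).mp hm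
  apply h (fun j => c (Sum.inl j)) (fun j => c (Sum.inr j))
  rw [← hc, Fintype.sum_sum_type]
  ext t
  simp only [Sum.elim_inl, Sum.elim_inr, LinearMap.add_apply, LinearMap.sum_apply,
    LinearMap.smul_apply, smul_eq_mul, neg_mul, Finset.sum_neg_distrib, LinearMap.zero_apply]
  ring

lemma step_two {r : ℕ} {ρ : (∀ i, G i) → F} (hρ : MultilinearOn F Finset.univ ρ)
    {βI : Fin r → Finset (Fin k)} {β : Fin r → (∀ i, G i) → F}
    (hβ : ∀ j, MultilinearOn F (βI j) (β j)) (d : Fin k) (u v : ∀ i, G i) (hu : S ρ β u)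
    (hv : S ρ β v) (h1 : ¬ ∃ lam lam', Bad hρ hβ d u v lam lam')
    (h2 : ¬ ∃ lam lam', Bad hρ hβ d v u lam lam') :
    (Fintype.card (G d) : ℝ) ≤ ((Fintype.card F : ℝ) ^ (r + 1)) ^ 2 *
      ∑ t : G d, ind (S ρ β (update u d t) ∧ S ρ β (update v d t)) := by
  push Not at h1 h2
  obtain ⟨t1, a1, b1, c1⟩ := exists_of_not_bad (slice hρ d u) (fun j => slice (hβ j) d u)
    (fun j => slice (hβ j) d v) h1
  obtain ⟨t2, a2, b2, c2⟩ := exists_of_not_bad (slice hρ d v) (fun j => slice (hβ j) d v)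
    (fun j => slice (hβ j) d u) h2
  have ht0 : ∃ t0, slice hρ d u t0 ≠ 0 ∧ slice hρ d v t0 ≠ 0 ∧
      (∀ j, slice (hβ j) d u t0 = 0) ∧ (∀ j, slice (hβ j) d v t0 = 0) := by
    by_cases e1 : slice hρ d v t1 = 0
    · by_cases e2 : slice hρ d u t2 = 0
      · refine ⟨t1 + t2, ?_, ?_, ?_, ?_⟩
        · simpa [e2] using a1
        · simpa [e1] using a2
        · intro j; simp [b1 j, c2 j]
        · intro j; simp [c1 j, b2 j]
      · exact ⟨t2, e2, a2, c2, b2⟩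
    · exact ⟨t1, a1, e1, b1, c1⟩
  obtain ⟨t0, p1, p2, p3, p4⟩ := ht0
  let ℓ : (Option (Fin r)) ⊕ (Option (Fin r)) → G d →ₗ[F] F := fun m => match m with
    | Sum.inl none => slice hρ d u
    | Sum.inl (some j) => slice (hβ j) d u
    | Sum.inr none => slice hρ d v
    | Sum.inr (some j) => slice (hβ j) d v
  have h := coset ℓ t0
  rw [Fintype.card_sum, Fintype.card_option, Fintype.card_fin, ← two_mul, mul_comm 2,
    pow_mul] at h
  refine h.trans (mul_le_mul_of_nonneg_left (Finset.sum_le_sum fun t _ => ind_mono ?_)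
    (by positivity))
  intro ht
  refine ⟨⟨?_, ?_⟩, ⟨?_, ?_⟩⟩
  · rw [← slice_mem hρ (Finset.mem_univ d)]
    have := ht (Sum.inl none)
    simp only [ℓ] at this
    rw [this]; exact p1
  · intro j
    rw [← slice_eq (hβ j) d u t (hu.2 j)]
    have := ht (Sum.inl (some j))
    simp only [ℓ] at this
    rw [this]; exact p3 j
  · rw [← slice_mem hρ (Finset.mem_univ d)]
    have := ht (Sum.inr none)
    simp only [ℓ] at this
    rw [this]; exact p2
  · intro j
    rw [← slice_eq (hβ j) d v t (hv.2 j)]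
    have := ht (Sum.inr (some j))
    simp only [ℓ] at this
    rw [this]; exact p4 j

/-- Number of good `z`. -/
lemma z_count {r : ℕ} {ρ : (∀ i, G i) → F} (hρ : MultilinearOn F Finset.univ ρ)
    {βI : Fin r → Finset (Fin k)} {β : Fin r → (∀ i, G i) → F}
    (hβ : ∀ j, MultilinearOn F (βI j) (β j)) (x : ∀ i, G i) (hx : S ρ β x) :
    (Fintype.card (∀ i, G i) : ℝ) ≤ ((Fintype.card F : ℝ) ^ (r + 1)) ^ k *
      ∑ z, ind (∀ j ≤ k, S ρ β (mix j x z)) := by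
  have key : ∀ m j, j + m = k → (Fintype.card (∀ i, G i) : ℝ) ≤
      ((Fintype.card F : ℝ) ^ (r + 1)) ^ m *
      ∑ z, ind (∀ i, j ≤ i → i ≤ k → S ρ β (mix i x z)) := by
    intro m
    induction m with
    | zero =>
      intro j hj
      have : ∀ z : ∀ i, G i, ind (∀ i, j ≤ i → i ≤ k → S ρ β (mix i x z)) = 1 := by
        intro z
        apply ind_true
        intro i h1 h2
        have : i = k := by omega
        subst this
        rw [mix_k]; exact hx
      simp [this]
    | succ m ih =>
      intro j hj
      refine (ih (j + 1) (by omega)).trans ?_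
      rw [pow_succ _ m, mul_assoc]
      apply mul_le_mul_of_nonneg_left _ (by positivity)
      apply fiber (⟨j, by omega⟩ : Fin k) _ _ _ _ (by positivity)
      intro z hz
      refine (step_one hρ hβ ⟨j, by omega⟩ (mix (j + 1) x z)
        (hz (j + 1) le_rfl (by omega))).trans ?_
      refine mul_le_mul_of_nonneg_left (Finset.sum_le_sum fun t _ => ind_mono ?_) (by positivity)
      intro ht i hi1 hi2
      by_cases hij : i = j
      · subst hij
        have := mix_update_right (⟨i, by omega⟩ : Fin k) x z t
        simp only at this
        rw [this]; exact ht
      · rw [mix_update_right_of_lt (⟨j, by omega⟩ : Fin k) i (by simp only; omega)]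
        exact hz i (by omega) hi2
  simpa using key k 0 (by omega)

lemma bad_total {r : ℕ} {ρ : (∀ i, G i) → F} (hρ : MultilinearOn F Finset.univ ρ)
    {βI : Fin r → Finset (Fin k)} {β : Fin r → (∀ i, G i) → F}
    (hβ : ∀ j, MultilinearOn F (βI j) (β j)) (χ : AddChar F ℂ) (hχ : χ ≠ 1) (B : ℝ)
    (hbias : ∀ lam : Fin r → F,
      ‖∑ x, χ (ρ x -
          ∑ j ∈ Finset.univ.filter (fun j => βI j = Finset.univ), lam j * β j x)‖ ≤ B)
    (d : Fin k) (w : ∀ i, G i) :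
    ∑ z : ∀ i, G i, ∑ b : ∀ i, G i,
      ind (∃ lam lam', Bad hρ hβ d (mix d.val b z) (mix d.val b w) lam lam')
      ≤ (Fintype.card (∀ i, G i) : ℝ) * ((Fintype.card F : ℝ) ^ (2 * r) * B) := by
  have h := sum_mix d.val
    (fun u => ind (∃ lam lam', Bad hρ hβ d u (mix d.val u w) lam lam'))
  simp only [mix_mix] at h
  rw [h, nsmul_eq_mul]
  apply mul_le_mul_of_nonneg_left _ (by positivity)
  calc ∑ u, ind (∃ lam lam', Bad hρ hβ d u (mix d.val u w) lam lam')
      ≤ ∑ u, ∑ lam : Fin r → F, ∑ lam' : Fin r → F,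
          ind (Bad hρ hβ d u (mix d.val u w) lam lam') := by
        apply Finset.sum_le_sum
        intro u _
        by_cases hu : ∃ lam lam', Bad hρ hβ d u (mix d.val u w) lam lam'
        · rw [ind_true hu]
          obtain ⟨lam, lam', hb⟩ := hu
          rw [← ind_true hb]
          refine le_trans ?_ (Finset.single_le_sum (f := fun l => ∑ lam' : Fin r → F,
            ind (Bad hρ hβ d u (mix d.val u w) l lam'))
            (fun l _ => Finset.sum_nonneg fun _ _ => ind_nonneg _) (Finset.mem_univ lam))
          exact Finset.single_le_sum (f := fun l' =>
            ind (Bad hρ hβ d u (mix d.val u w) lam l'))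
            (fun l _ => ind_nonneg _) (Finset.mem_univ lam')
        · rw [ind_false hu]
          exact Finset.sum_nonneg fun _ _ => Finset.sum_nonneg fun _ _ => ind_nonneg _
    _ = ∑ lam : Fin r → F, ∑ lam' : Fin r → F, ∑ u,
          ind (Bad hρ hβ d u (mix d.val u w) lam lam') := by
        rw [Finset.sum_comm]
        apply Finset.sum_congr rfl
        intro lam _
        rw [Finset.sum_comm]
    _ ≤ ∑ lam : Fin r → F, ∑ lam' : Fin r → F, B := by
        apply Finset.sum_le_sum
        intro lam _
        apply Finset.sum_le_sum
        intro lam' _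
        exact bad_count hρ hβ χ hχ B hbias d w lam lam'
    _ = (Fintype.card F : ℝ) ^ (2 * r) * B := by
        simp
        ring

lemma exists_good {r : ℕ} {ρ : (∀ i, G i) → F} (hρ : MultilinearOn F Finset.univ ρ)
    {βI : Fin r → Finset (Fin k)} {β : Fin r → (∀ i, G i) → F}
    (hβ : ∀ j, MultilinearOn F (βI j) (β j)) (χ : AddChar F ℂ) (hχ : χ ≠ 1)
    (hbias : ∀ lam : Fin r → F,
      ‖∑ x, χ (ρ x -
          ∑ j ∈ Finset.univ.filter (fun j => βI j = Finset.univ), lam j * β j x)‖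
        ≤ (Fintype.card (∀ i, G i) : ℝ) / ((Fintype.card F : ℝ) ^ (r + 1)) ^ (4 * (k + 1)))
    (x y : ∀ i, G i) (hx : S ρ β x) (hy : S ρ β y) :
    ∃ z w b : ∀ i, G i, (∀ j ≤ k, S ρ β (mix j x z)) ∧ (∀ j ≤ k, S ρ β (mix j y w)) ∧
      (∀ j ≤ k, S ρ β (mix j b z) ∧ S ρ β (mix j b w)) := by
  set N : ℝ := (Fintype.card (∀ i, G i) : ℝ) with hN
  have hNpos : 0 < N := by
    rw [hN]; exact_mod_cast Fintype.card_pos_iff.mpr ⟨x⟩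
  set f : ℝ := (Fintype.card F : ℝ) with hf
  have hf2 : 2 ≤ f := by
    rw [hf]; exact_mod_cast Fintype.one_lt_card
  set K : ℝ := f ^ (r + 1) with hK
  have hK2 : 2 ≤ K := by
    rw [hK, pow_succ]
    have : 1 ≤ f ^ r := one_le_pow₀ (by linarith)
    nlinarith
  set B : ℝ := N / K ^ (4 * (k + 1)) with hB
  set E : ℝ := 2 * (N * (N * (f ^ (2 * r) * B))) with hE
  let Zx : (∀ i, G i) → Prop := fun z => ∀ j ≤ k, S ρ β (mix j x z)
  let Zy : (∀ i, G i) → Prop := fun w => ∀ j ≤ k, S ρ β (mix j y w)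
  let P : ℕ → (∀ i, G i) → (∀ i, G i) → (∀ i, G i) → Prop := fun j z w b =>
    Zx z ∧ Zy w ∧ ∀ i ≤ j, S ρ β (mix i b z) ∧ S ρ β (mix i b w)
  let A : ℕ → ℝ := fun j => ∑ z : ∀ i, G i, ∑ w : ∀ i, G i, ∑ b : ∀ i, G i, ind (P j z w b)
  have hA0 : N ^ 3 ≤ K ^ (2 * k) * A 0 := by
    have h1 : N ≤ K ^ k * ∑ z, ind (Zx z) := z_count hρ hβ x hx
    have h2 : N ≤ K ^ k * ∑ z, ind (Zy z) := z_count hρ hβ y hy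
    have h3 : A 0 = (∑ z, ind (Zx z)) * (∑ z, ind (Zy z)) * N := by
      simp only [A]
      rw [Finset.sum_mul_sum, Finset.sum_mul]
      apply Finset.sum_congr rfl
      intro z _
      rw [Finset.sum_mul]
      apply Finset.sum_congr rfl
      intro w _
      have : ∀ b, ind (P 0 z w b) = ind (Zx z) * ind (Zy w) := by
        intro b
        by_cases hz : Zx z
        · by_cases hw : Zy w
          · rw [ind_true hz, ind_true hw, ind_true, mul_one]
            refine ⟨hz, hw, ?_⟩
            intro i hi
            have hi0 : i = 0 := by omega
            subst hi0
            have a1 := hz 0 (Nat.zero_le _)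
            have a2 := hw 0 (Nat.zero_le _)
            rw [mix_zero] at a1 a2
            rw [mix_zero, mix_zero]
            exact ⟨a1, a2⟩
          · rw [ind_false hw, mul_zero]
            exact ind_false fun h => hw h.2.1
        · rw [ind_false hz, zero_mul]
          exact ind_false fun h => hz h.1
      simp only [this]
      simp [hN, mul_comm]
    rw [h3]
    have h4 := mul_le_mul h1 h2 hNpos.le (hNpos.le.trans h1)
    calc N ^ 3 = (N * N) * N := by ring
      _ ≤ (K ^ k * (∑ z, ind (Zx z)) * (K ^ k * ∑ z, ind (Zy z))) * N :=
          mul_le_mul_of_nonneg_right h4 hNpos.le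
      _ = _ := by ring
  have hstep : ∀ j < k, A j ≤ E + K ^ 2 * A (j + 1) := by
    intro j hj
    let d : Fin k := ⟨j, hj⟩
    let b1 : (∀ i, G i) → (∀ i, G i) → (∀ i, G i) → Prop := fun z w b =>
      ∃ lam lam', Bad hρ hβ d (mix d.val b z) (mix d.val b w) lam lam'
    have hb1 : ∑ z : ∀ i, G i, ∑ w : ∀ i, G i, ∑ b : ∀ i, G i, ind (b1 z w b)
        ≤ N * (N * (f ^ (2 * r) * B)) := by
      rw [Finset.sum_comm]
      calc _ ≤ ∑ w : ∀ i, G i, (N * (f ^ (2 * r) * B)) :=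
            Finset.sum_le_sum fun w _ => bad_total hρ hβ χ hχ B hbias d w
        _ = _ := by simp [hN]
    have hb2 : ∑ z : ∀ i, G i, ∑ w : ∀ i, G i, ∑ b : ∀ i, G i, ind (b1 w z b)
        ≤ N * (N * (f ^ (2 * r) * B)) := by
      rw [Finset.sum_comm]; exact hb1
    have hin : ∀ z w : ∀ i, G i, ∑ b, ind (P j z w b) ≤
        (∑ b, ind (b1 z w b)) + (∑ b, ind (b1 w z b)) + K ^ 2 * ∑ b, ind (P (j + 1) z w b) := by
      intro z w
      have hfib := fiber d (fun b => P j z w b ∧ ¬ b1 z w b ∧ ¬ b1 w z b)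
        (fun b => P (j + 1) z w b) (K ^ 2) (by
          rintro b ⟨hP, hn1, hn2⟩
          refine (step_two hρ hβ d (mix d.val b z) (mix d.val b w) (hP.2.2 j le_rfl).1
            (hP.2.2 j le_rfl).2 hn1 hn2).trans ?_
          refine mul_le_mul_of_nonneg_left (Finset.sum_le_sum fun t _ => ind_mono ?_)
            (by positivity)
          intro ht
          refine ⟨hP.1, hP.2.1, ?_⟩
          intro i hi
          by_cases hij : i ≤ j
          · rw [mix_update_of_le d i hij, mix_update_of_le d i hij]
            exact hP.2.2 i hij
          · have hi' : i = d.val + 1 := by simp only [d]; omega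
            rw [hi', mix_succ_update, mix_succ_update]
            exact ht) (by positivity)
      refine le_trans ?_ (add_le_add_right hfib _)
      rw [← Finset.sum_add_distrib, ← Finset.sum_add_distrib]
      apply Finset.sum_le_sum
      intro b _
      have n1 := ind_nonneg (b1 z w b)
      have n2 := ind_nonneg (b1 w z b)
      have n3 := ind_nonneg (P j z w b ∧ ¬ b1 z w b ∧ ¬ b1 w z b)
      by_cases hp : P j z w b
      · rw [ind_true hp]
        by_cases h1 : b1 z w b
        · rw [ind_true h1]; linarith
        · by_cases h2 : b1 w z b
          · rw [ind_true h2]; linarith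
          · rw [ind_true (⟨hp, h1, h2⟩ : P j z w b ∧ ¬ b1 z w b ∧ ¬ b1 w z b)]; linarith
      · rw [ind_false hp]; linarith
    have htot : A j ≤ ∑ z : ∀ i, G i, ∑ w : ∀ i, G i, ((∑ b, ind (b1 z w b))
        + (∑ b, ind (b1 w z b)) + K ^ 2 * ∑ b, ind (P (j + 1) z w b)) :=
      Finset.sum_le_sum fun z _ => Finset.sum_le_sum fun w _ => hin z w
    simp only [Finset.sum_add_distrib, ← Finset.mul_sum] at htot
    simp only [A] at htot ⊢
    rw [hE]
    linarith
  have hB0 : 0 ≤ B := by rw [hB]; positivity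
  have hE0 : 0 ≤ E := by rw [hE]; positivity
  have hA0' : ∀ j, 0 ≤ A j := fun j => Finset.sum_nonneg fun _ _ => Finset.sum_nonneg fun _ _ =>
    Finset.sum_nonneg fun _ _ => ind_nonneg _
  have hchain : ∀ j ≤ k, N ^ 3 ≤ K ^ (2 * k + 2 * j) * (A j + E) := by
    intro j
    induction j with
    | zero =>
      intro _
      refine hA0.trans ?_
      simp only [mul_zero, add_zero]
      apply mul_le_mul_of_nonneg_left _ (by positivity)
      linarith
    | succ j ih =>
      intro hj
      refine (ih (by omega)).trans ?_
      have h1 := hstep j (by omega)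
      have h2 : A j + E ≤ K ^ 2 * (A (j + 1) + E) := by
        have h4 : 2 * E ≤ K ^ 2 * E := mul_le_mul_of_nonneg_right (by nlinarith) hE0
        linarith
      calc K ^ (2 * k + 2 * j) * (A j + E)
          ≤ K ^ (2 * k + 2 * j) * (K ^ 2 * (A (j + 1) + E)) :=
            mul_le_mul_of_nonneg_left h2 (by positivity)
        _ = _ := by ring
  by_contra hcon
  have hAk : A k = 0 := by
    simp only [A]
    refine Finset.sum_eq_zero fun z _ => Finset.sum_eq_zero fun w _ =>
      Finset.sum_eq_zero fun b _ => ind_false ?_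
    intro h
    exact hcon ⟨z, w, b, h⟩
  have hfin := hchain k le_rfl
  rw [hAk, zero_add, hE, hB] at hfin
  have hKpos : 0 < K := by linarith
  have e1 : K ^ (2 * k + 2 * k) * (2 * (N * (N * (f ^ (2 * r) * (N / K ^ (4 * (k + 1)))))))
      = N ^ 3 * (2 * f ^ (2 * r) / K ^ 4) := by
    have : K ^ (4 * (k + 1)) = K ^ (2 * k + 2 * k) * K ^ 4 := by ring
    rw [this]
    field_simp
  rw [e1] at hfin
  have e2 : 2 * f ^ (2 * r) < K ^ 4 := by
    have e3 : 2 * f ^ (2 * r) ≤ K ^ 2 := by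
      rw [hK]
      have : (f ^ (r + 1)) ^ 2 = f ^ (2 * r) * f ^ 2 := by ring
      rw [this]
      have h0 : 0 < f ^ (2 * r) := by positivity
      rw [mul_comm]
      exact mul_le_mul_of_nonneg_left (by nlinarith) h0.le
    exact lt_of_le_of_lt e3 (pow_lt_pow_right₀ (by linarith) (by norm_num))
  have e4 : 2 * f ^ (2 * r) / K ^ 4 < 1 := by
    rw [div_lt_one (by positivity)]; exact e2
  have : 0 < N ^ 3 := by positivity
  nlinarith

end Count

end LP

/-- Under the one-sided regularity bias hypothesis, any two points `x, y`
with `ρ ≠ 0` and all `βᵢ = 0` are joined by a short path: there are points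
`q⁰ = x, q¹, …, q^s = (λ₁y₁, …, λ_k y_k)` with nonzero `λᵢ`, consecutive points differing
in exactly one coordinate, `s ≤ (2k+1)(2^k-1)`, `ρ` constant along the path and all `βⱼ`
vanishing along it. -/
theorem layer_path {k r : ℕ} {F : Type*} [Field F] [Fintype F]
    {G : Fin k → Type*} [∀ i, AddCommGroup (G i)] [∀ i, Module F (G i)]
    [∀ i, Fintype (G i)]
    (χ : AddChar F ℂ) (hχ : χ ≠ 1)
    (ρ : (∀ i, G i) → F) (hρ : MultilinearOn F Finset.univ ρ)
    (βI : Fin r → Finset (Fin k)) (β : Fin r → ((∀ i, G i) → F))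
    (hβ : ∀ j, MultilinearOn F (βI j) (β j))
    (hbias : ∀ lam : Fin r → F,
      ‖expChar χ (fun x => ρ x -
          ∑ j ∈ Finset.univ.filter (fun j => βI j = Finset.univ), lam j * β j x)‖
        ≤ (Fintype.card F : ℝ) ^ (-((4 * (k + 1) * (r + 1) : ℕ) : ℤ)))
    (x y : ∀ i, G i) (hx : ρ x ≠ 0) (hy : ρ y ≠ 0)
    (hxβ : ∀ j, β j x = 0) (hyβ : ∀ j, β j y = 0) :
    ∃ (s : ℕ) (q : ℕ → ∀ i, G i) (lam : Fin k → F),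
      s ≤ (2 * k + 1) * (2 ^ k - 1) ∧
      (∀ t < s, ∃ d : Fin k, q t d ≠ q (t + 1) d ∧ ∀ i ≠ d, q t i = q (t + 1) i) ∧
      q 0 = x ∧ (∀ i, lam i ≠ 0) ∧ q s = (fun i => lam i • y i) ∧
      (∀ t ≤ s, ρ (q t) = ρ x) ∧ (∀ t ≤ s, ∀ j, β j (q t) = 0) := by
  have hS : LP.S ρ β x := ⟨hx, hxβ⟩
  have hS' : LP.S ρ β y := ⟨hy, hyβ⟩
  suffices h : LP.L ρ β x ((2 * k + 1) * (2 ^ k - 1)) y from h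
  have hmono : ∀ n, n ≤ (2 * k + 1) * (2 ^ k - 1) → LP.L ρ β x n y →
      LP.L ρ β x ((2 * k + 1) * (2 ^ k - 1)) y := by
    rintro n hn ⟨s, q, lam, hs, hrest⟩
    exact ⟨s, q, lam, hs.trans hn, hrest⟩
  rcases Nat.lt_or_ge k 2 with hk | hk
  · rcases Nat.lt_or_ge k 1 with hk0 | hk1
    · have hk0' : k = 0 := by omega
      subst hk0'
      have hxy : x = y := Subsingleton.elim _ _
      rw [← hxy]
      exact LP.L_zero hS
    · have hk1' : k = 1 := by omega
      subst hk1'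
      refine hmono 1 (by norm_num) (LP.L_step hρ hβ hx (LP.L_zero hS) hS' 0 ?_)
      intro i hi
      exact absurd (Subsingleton.elim i 0) hi
  · have hNpos : (0 : ℝ) < (Fintype.card (∀ i, G i) : ℝ) := by
      exact_mod_cast Fintype.card_pos_iff.mpr ⟨x⟩
    obtain ⟨z, w, b, h1, h2, h3⟩ := LP.exists_good hρ hβ χ hχ (by
      intro lam
      have h := hbias lam
      rw [expChar, norm_div, Complex.norm_natCast, div_le_iff₀ hNpos] at h
      refine h.trans (le_of_eq ?_)
      rw [zpow_neg, zpow_natCast, ← pow_mul, div_eq_mul_inv, mul_comm]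
      congr 3
      ring) x y hS hS'
    have p0 := LP.L_down hρ hβ hx (LP.L_zero hS) h1
    have p1 := LP.L_up hρ hβ hx p0 (fun j hj => (h3 j hj).1)
    have p2 := LP.L_down hρ hβ hx p1 (fun j hj => (h3 j hj).2)
    have p3 := LP.L_up hρ hβ hx p2 h2
    refine hmono _ ?_ p3
    have h4 : 2 ^ 2 ≤ 2 ^ k := Nat.pow_le_pow_right (by norm_num) hk
    have h5 : 3 ≤ 2 ^ k - 1 := by omega
    calc 0 + k + k + k + k ≤ (2 * k + 1) * 3 := by omega
      _ ≤ (2 * k + 1) * (2 ^ k - 1) := Nat.mul_le_mul_left _ h5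
end

section
/- Let β : G_1 × G_2 → F_p^d be a bilinear map satisfying |E_{x∈G_1, y∈G_2} ω^{λ·β(x,y)}| ≤ p^{−r} for all nonzero λ ∈ F_p^d, where ω = e^{2πi/p} and r ≥ 20d. Let D = {(x,y) : β(x,y) = 0} and let φ : D → H be bilinear in the sense that each slice map is linear where defined. Then there is a globally bilinear map Φ : G_1 × G_2 → H with Φ = φ on all of D. -/
open scoped BigOperators

/-- `φ` is bilinear on the set `D ⊆ G₁ × G₂`: each one-variable slice is linear where
defined. -/
def BilinearOnSet {F : Type*} [Field F] {G₁ G₂ H : Type*}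
    [AddCommGroup G₁] [Module F G₁] [AddCommGroup G₂] [Module F G₂]
    [AddCommGroup H] [Module F H]
    (D : Set (G₁ × G₂)) (φ : G₁ → G₂ → H) : Prop :=
  (∀ x y y', (x, y) ∈ D → (x, y') ∈ D → φ x (y + y') = φ x y + φ x y') ∧
  (∀ x (c : F) y, (x, y) ∈ D → φ x (c • y) = c • φ x y) ∧
  (∀ x x' y, (x, y) ∈ D → (x', y) ∈ D → φ (x + x') y = φ x y + φ x' y) ∧
  (∀ (c : F) x y, (x, y) ∈ D → φ (c • x) y = c • φ x y)

namespace HRB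

open Module

section algebra

variable {F G₁ G₂ H W T : Type*} [Field F]
    [AddCommGroup G₁] [Module F G₁] [AddCommGroup G₂] [Module F G₂]
    [AddCommGroup H] [Module F H] [AddCommGroup W] [Module F W]
    [AddCommGroup T] [Module F T]

/-- `g` is bad relative to `f`. -/
def Bad (f : G₁ →ₗ[F] W) (g : G₁ →ₗ[F] T) : Prop :=
  ∃ ψ : Dual F T, ψ ≠ 0 ∧ ∃ χ : Dual F W, ∀ x, ψ (g x) = χ (f x)

lemma Bad.neg {f : G₁ →ₗ[F] W} {g : G₁ →ₗ[F] T} (h : Bad f g) : Bad f (-g) := by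
  obtain ⟨ψ, h0, χ, hx⟩ := h
  exact ⟨ψ, h0, -χ, fun x => by simp [hx]⟩

lemma surj_of_not_bad {f : G₁ →ₗ[F] W} {g : G₁ →ₗ[F] T} (hf : Function.Surjective f)
    (h : ¬ Bad f g) : Function.Surjective (f.prod g) := by
  by_contra hs
  rw [← LinearMap.range_eq_top] at hs
  obtain ⟨θ, hθ, hle⟩ := Submodule.exists_le_ker_of_lt_top _ (lt_top_iff_ne_top.2 hs)
  have key : ∀ x, θ (f x, 0) + θ (0, g x) = 0 := by
    intro x
    rw [← map_add]
    have : f.prod g x ∈ LinearMap.ker θ := hle ⟨x, rfl⟩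
    simpa using this
  by_cases h2 : θ ∘ₗ LinearMap.inr F W T = 0
  · apply hθ
    have h2' : ∀ t, θ (0, t) = 0 := fun t => by simpa using LinearMap.congr_fun h2 t
    ext t
    · obtain ⟨x, rfl⟩ := hf t
      have := key x
      rw [h2', add_zero] at this
      simpa using this
    · simpa using h2' t
  · apply h
    refine ⟨_, h2, -(θ ∘ₗ LinearMap.inl F W T), fun x => ?_⟩
    have := key x
    simp only [LinearMap.comp_apply, LinearMap.inr_apply, LinearMap.inl_apply, LinearMap.neg_apply]
    linear_combination this

/-- Extension `E y`. -/
lemma exists_E (β : G₁ →ₗ[F] G₂ →ₗ[F] T) (L : G₂ → G₁ →ₗ[F] H)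
    (hL : ∀ x y y', β x y = 0 → β x y' = 0 → L (y + y') x = L y x + L y' x) (v y : G₂)
    (hs : Function.Surjective ((β.flip v).prod (β.flip y))) :
    ∃ E : G₁ →ₗ[F] H, (∀ x, β x y = 0 → E x = L y x) ∧
      (∀ x, β x y = β x v → E x = L (y - v) x + L v x) := by
  obtain ⟨s, hs⟩ := LinearMap.exists_rightInverse_of_surjective _ (LinearMap.range_eq_top.2 hs)
  have hs1 : ∀ t, β (s t) v = t.1 := fun t => by
    simpa using congrArg Prod.fst (LinearMap.congr_fun hs t)
  have hs2 : ∀ t, β (s t) y = t.2 := fun t => by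
    simpa using congrArg Prod.snd (LinearMap.congr_fun hs t)
  let q : G₁ →ₗ[F] G₁ := s ∘ₗ ((β.flip y).prod (β.flip y))
  have hq : ∀ x, q x = s (β x y, β x y) := fun x => rfl
  refine ⟨L y ∘ₗ (LinearMap.id - q) + (L (y - v) + L v) ∘ₗ q, ?_, ?_⟩
  · intro x hx
    have : q x = 0 := by rw [hq, hx]; exact map_zero s
    simp [this]
  · intro x hx
    have e1 : β (x - q x) v = 0 := by simp [hq, hs1, hx]
    have e2 : β (x - q x) y = 0 := by simp [hq, hs2]
    have := hL (x - q x) (y - v) v (by rw [map_sub, e1, e2, sub_zero]) e1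
    rw [sub_add_cancel] at this
    simp only [LinearMap.add_apply, LinearMap.comp_apply, LinearMap.sub_apply, LinearMap.id_apply,
      this, map_sub]
    abel

lemma E_add (β : G₁ →ₗ[F] G₂ →ₗ[F] T) (L : G₂ → G₁ →ₗ[F] H)
    (hL : ∀ x y y', β x y = 0 → β x y' = 0 → L (y + y') x = L y x + L y' x) (v : G₂)
    (E : G₂ → G₁ →ₗ[F] H)
    (hE : ∀ y, Function.Surjective ((β.flip v).prod (β.flip y)) →
      (∀ x, β x y = 0 → E y x = L y x) ∧
      (∀ x, β x y = β x v → E y x = L (y - v) x + L v x)) (y z : G₂)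
    (hs : Function.Surjective (((β.flip v).prod (β.flip y)).prod (β.flip z))) :
    E (y + z) = E y + E z := by
  have hs' : ∀ a b c, ∃ x, β x v = a ∧ β x y = b ∧ β x z = c := fun a b c => by
    obtain ⟨x, hx⟩ := hs ((a, b), c)
    simp only [LinearMap.prod_apply, Function.prod_apply, LinearMap.flip_apply, Prod.mk.injEq] at hx
    exact ⟨x, hx.1.1, hx.1.2, hx.2⟩
  obtain ⟨y1, y2⟩ := hE y (fun t => by
    obtain ⟨x, h1, h2, h3⟩ := hs' t.1 t.2 0
    exact ⟨x, by simp [h1, h2]⟩)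
  obtain ⟨z1, z2⟩ := hE z (fun t => by
    obtain ⟨x, h1, h2, h3⟩ := hs' t.1 0 t.2
    exact ⟨x, by simp [h1, h3]⟩)
  obtain ⟨w1, w2⟩ := hE (y + z) (fun t => by
    obtain ⟨x, h1, h2, h3⟩ := hs' t.1 0 t.2
    exact ⟨x, by simp [h1, h2, h3]⟩)
  -- three families
  have A : ∀ x, β x y = 0 → β x z = 0 → E (y + z) x = E y x + E z x := fun x h1 h2 => by
    rw [w1 x (by simp [h1, h2]), y1 x h1, z1 x h2, hL x y z h1 h2]
  have B : ∀ x, β x y = 0 → β x z = β x v → E (y + z) x = E y x + E z x := fun x h1 h2 => by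
    rw [w2 x (by simp [h1, h2]), y1 x h1, z2 x h2, add_sub_assoc, hL x y (z - v) h1 (by simp [h2])]
    abel
  have C : ∀ x, β x z = 0 → β x y = β x v → E (y + z) x = E y x + E z x := fun x h1 h2 => by
    rw [w2 x (by simp [h1, h2]), z1 x h1, y2 x h2, add_comm y z, add_sub_assoc,
      hL x z (y - v) h1 (by simp [h2])]
    abel
  ext x
  obtain ⟨b, b1, b2, b3⟩ := hs' (β x z) 0 (β x z)
  obtain ⟨c, c1, c2, c3⟩ := hs' (β x y) (β x y) 0
  have hb := B b b2 (b3.trans b1.symm)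
  have hc := C c c3 (c2.trans c1.symm)
  have ha := A (x - b - c) (by simp [b2, c2]) (by simp [b3, c3])
  simp only [map_sub, LinearMap.add_apply] at ha ⊢
  rw [hb, hc] at ha
  have : E (y+z) x = (E (y + z) x - (E y b + E z b) - (E y c + E z c)) + (E y b + E z b) + (E y c + E z c) := by abel
  rw [this, ha]
  abel

end algebra

section main

variable {p : ℕ} [Fact p.Prime] {G₁ G₂ H : Type*}
    [AddCommGroup G₁] [Module (ZMod p) G₁] [AddCommGroup G₂] [Module (ZMod p) G₂]
    [AddCommGroup H] [Module (ZMod p) H]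

/-- Abstract genericity supply. -/
def Supply {T : Type*} [AddCommGroup T] [Module (ZMod p) T]
    (β : G₁ →ₗ[ZMod p] G₂ →ₗ[ZMod p] T) : Prop :=
  ∀ (x : G₁) (f : Fin 4 → G₁ →ₗ[ZMod p] (T × T)) (c : Fin 4 → G₂),
    ∃ z, β x z = 0 ∧ ∀ i, ¬ Bad (f i) (β.flip (z - c i))

lemma main_of_supply {T : Type*} [AddCommGroup T] [Module (ZMod p) T]
    (β : G₁ →ₗ[ZMod p] G₂ →ₗ[ZMod p] T) (hS : Supply β) (L : G₂ → G₁ →ₗ[ZMod p] H)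
    (hL : ∀ x y y', β x y = 0 → β x y' = 0 → L (y + y') x = L y x + L y' x) :
    ∃ Φ : G₁ →ₗ[ZMod p] G₂ →ₗ[ZMod p] H, ∀ x y, β x y = 0 → Φ x y = L y x := by
  -- choose v
  obtain ⟨v, -, hv⟩ := hS 0 (fun _ => 0) (fun _ => 0)
  have hv1 : Function.Surjective (β.flip v) := by
    have h0 : ¬ Bad (0 : G₁ →ₗ[ZMod p] (Fin 0 → ZMod p)) (β.flip v) := by
      rintro ⟨ψ, h0, χ, hx⟩
      exact hv 0 ⟨ψ, h0, 0, fun x => by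
        rw [sub_zero, hx x, LinearMap.zero_apply, map_zero, LinearMap.zero_apply]⟩
    have := surj_of_not_bad (Function.surjective_to_subsingleton _) h0
    intro t
    obtain ⟨x, hx⟩ := this (0, t)
    exact ⟨x, congrArg Prod.snd hx⟩
  let f2 : G₁ →ₗ[ZMod p] T × T := (β.flip v).prod 0
  have good2 : ∀ y, ¬ Bad f2 (β.flip y) →
      Function.Surjective ((β.flip v).prod (β.flip y)) := fun y hy => by
    apply surj_of_not_bad hv1
    rintro ⟨ψ, h0, χ, hx⟩
    exact hy ⟨ψ, h0, χ ∘ₗ LinearMap.fst _ _ _, fun x => by simpa [f2] using hx x⟩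
  have flipneg : ∀ {f : G₁ →ₗ[ZMod p] T × T} {a b : G₂}, ¬ Bad f (β.flip (a - b)) →
      ¬ Bad f (β.flip (b - a)) := fun {f a b} h h' => h (by
    have := h'.neg
    rwa [← map_neg, neg_sub] at this)
  have hEx : ∀ y, ∃ E : G₁ →ₗ[ZMod p] H,
      Function.Surjective ((β.flip v).prod (β.flip y)) →
      (∀ x, β x y = 0 → E x = L y x) ∧
      (∀ x, β x y = β x v → E x = L (y - v) x + L v x) := fun y => by
    by_cases h : Function.Surjective ((β.flip v).prod (β.flip y))
    · obtain ⟨E, hE⟩ := exists_E β L hL v y h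
      exact ⟨E, fun _ => hE⟩
    · exact ⟨0, fun h' => absurd h' h⟩
  choose E hE using hEx
  have hadd := E_add β L hL v E hE
  -- shorthand
  let f3 : G₂ → G₁ →ₗ[ZMod p] T × T := fun y => (β.flip v).prod (β.flip y)
  let Gd : G₂ → Prop := fun y => Function.Surjective (f3 y)
  have add3 : ∀ y z, Gd y → ¬ Bad (f3 y) (β.flip z) → E (y + z) = E y + E z :=
    fun y z hy hz => hadd y z (surj_of_not_bad hy hz)
  -- good sums
  have gd3 : ∀ y z, Gd y → ¬ Bad (f3 y) (β.flip z) → Gd z ∧ Gd (y + z) := by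
    intro y z hy hz
    have hs := surj_of_not_bad hy hz
    constructor
    · intro t
      obtain ⟨x, hx⟩ := hs ((t.1, 0), t.2)
      simp only [f3, LinearMap.prod_apply, Function.prod_apply, LinearMap.flip_apply, Prod.mk.injEq] at hx
      exact ⟨x, by simp [f3, hx]⟩
    · intro t
      obtain ⟨x, hx⟩ := hs ((t.1, 0), t.2)
      simp only [f3, LinearMap.prod_apply, Function.prod_apply, LinearMap.flip_apply, Prod.mk.injEq] at hx
      exact ⟨x, by simp [f3, hx]⟩
  -- w versions: E w = E y + E (w - y)
  have bad_shift : ∀ y w, ¬ Bad (f3 y) (β.flip w) → ¬ Bad (f3 y) (β.flip (w - y)) := by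
    rintro y w h ⟨ψ, h0, χ, hx⟩
    refine h ⟨ψ, h0, χ + ψ ∘ₗ LinearMap.snd _ _ _, fun x => ?_⟩
    have := hx x
    simp only [f3, map_sub, LinearMap.sub_apply, LinearMap.flip_apply, LinearMap.prod_apply, Function.prod_apply,
      LinearMap.add_apply, LinearMap.comp_apply, LinearMap.snd_apply] at this ⊢
    linear_combination this
  have split : ∀ y w, Gd y → ¬ Bad (f3 y) (β.flip w) → E w = E y + E (w - y) := by
    intro y w hy hw
    have := add3 y (w - y) hy (bad_shift y w hw)
    rwa [add_sub_cancel] at this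
  -- well-definedness
  have Q : ∀ a b a' b', Gd a → Gd b → Gd a' → Gd b' → a + b = a' + b' →
      E a + E b = E a' + E b' := by
    intro a b a' b' ha hb ha' hb' h
    obtain ⟨w, -, hw⟩ := hS 0 ![f3 a, f3 b, f3 a', f3 b'] ![0, a + b, 0, a + b]
    have h0 := hw 0
    have h1 := flipneg (hw 1)
    have h2 := hw 2
    have h3 := flipneg (hw 3)
    simp only [Matrix.cons_val, sub_zero] at h0 h1 h2 h3
    have one : ∀ a b, Gd a → Gd b → ¬ Bad (f3 a) (β.flip w) → ¬ Bad (f3 b) (β.flip (a + b - w)) →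
        E a + E b = E w + E (a + b - w) := by
      intro a b ha hb h0 h1
      have e1 := split a w ha h0
      have e2 := add3 b (-(w - a)) hb (by
        have := bad_shift b _ h1
        rwa [show a + b - w - b = -(w - a) by abel] at this)
      -- E (a+b-w) = E b + E (a - w)
      have e3 := add3 (a) (w - a) ha (bad_shift a w h0)
      have h4 : ¬ Bad (f3 b) (β.flip (w - a)) := by
        intro hb
        have := hb.neg
        rw [← map_neg] at this
        have h5 := bad_shift b _ h1
        rw [show a + b - w - b = -(w - a) by abel] at h5
        exact h5 this
      -- E b = E (w - a) + E (b - (w - a))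
      have gw := (gd3 a (w - a) ha (bad_shift a w h0)).1
      have gb := surj_of_not_bad hb h4
      have h6 : Function.Surjective
          (((β.flip v).prod (β.flip (w - a))).prod (β.flip (a + b - w))) := by
        intro t
        obtain ⟨x, hx⟩ := gb ((t.1.1, t.2 + t.1.2), t.1.2)
        simp only [f3, LinearMap.prod_apply, Function.prod_apply, LinearMap.flip_apply, Prod.mk.injEq] at hx
        obtain ⟨⟨hx1, hx2⟩, hx3⟩ := hx
        refine ⟨x, ?_⟩
        have : β x (a + b - w) = t.2 := by
          rw [show a + b - w = b - (w - a) by abel, map_sub, hx2, hx3]; abel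
        simp only [LinearMap.prod_apply, Function.prod_apply, LinearMap.flip_apply, hx1, hx3, this]
      have e5 := hadd _ _ h6
      rw [show w - a + (a + b - w) = b by abel] at e5
      rw [e5, e1]
      abel
    rw [one a b ha hb h0 h1, one a' b' ha' hb' h2 (by rwa [← h]), h]
  -- decompositions
  have dec : ∀ y, ∃ a, Gd a ∧ Gd (y - a) := by
    intro y
    obtain ⟨w, -, hw⟩ := hS 0 (fun _ => f2) ![0, y, 0, y]
    have h0 := hw 0
    have h1 := flipneg (hw 1)
    simp only [Matrix.cons_val, sub_zero] at h0 h1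
    exact ⟨w, good2 _ h0, good2 _ h1⟩
  choose a ha hya using dec
  let Ψ : G₂ → G₁ →ₗ[ZMod p] H := fun y => E (a y) + E (y - a y)
  have hΨ : ∀ y b b', Gd b → Gd b' → b + b' = y → Ψ y = E b + E b' := by
    intro y b b' hb hb' h
    exact Q _ _ _ _ (ha y) (hya y) hb hb' (by rw [h]; abel)
  let Ψ' : G₂ →+ (G₁ →ₗ[ZMod p] H) := AddMonoidHom.mk' Ψ (by
    intro y y'
    obtain ⟨b, -, hw⟩ := hS 0 ![f3 (a y), f3 (y - a y), f3 (a y), f3 (y - a y)] ![0, y', 0, y']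
    have h0 := hw 0
    have h1 := flipneg (hw 1)
    simp only [Matrix.cons_val, sub_zero] at h0 h1
    obtain ⟨g1, g2⟩ := gd3 _ _ (ha y) h0
    obtain ⟨g3, g4⟩ := gd3 _ _ (hya y) h1
    rw [hΨ (y + y') _ _ g2 g4 (by abel), hΨ y' b (y' - b) g1 g3 (by abel),
      add3 _ _ (ha y) h0, add3 _ _ (hya y) h1]
    simp only [Ψ]
    abel)
  refine ⟨(Ψ'.toZModLinearMap p).flip, fun x y hxy => ?_⟩
  change Ψ y x = _
  obtain ⟨w, hw0, hw⟩ := hS x (fun _ => f2) ![0, y, 0, y]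
  have h0 := hw 0
  have h1 := flipneg (hw 1)
  simp only [Matrix.cons_val, sub_zero] at h0 h1
  have hw1 : β x (y - w) = 0 := by rw [map_sub, hxy, hw0, sub_zero]
  rw [hΨ y w (y - w) (good2 _ h0) (good2 _ h1) (by abel), LinearMap.add_apply,
    (hE w (good2 _ h0)).1 x hw0, (hE _ (good2 _ h1)).1 x hw1, ← hL x _ _ hw0 hw1, add_sub_cancel]

end main

section count

variable {p : ℕ} [Fact p.Prime] {G₁ G₂ : Type*}
    [AddCommGroup G₁] [Module (ZMod p) G₁] [AddCommGroup G₂] [Module (ZMod p) G₂]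
    [Fintype G₁] [Fintype G₂]

open Classical in
lemma char_sum (ω : ℂ) (hω : IsPrimitiveRoot ω p) (l : G₁ →ₗ[ZMod p] ZMod p) :
    ∑ x, ω ^ (l x).val = if l = 0 then (Fintype.card G₁ : ℂ) else 0 := by
  have hp : (p : ℕ) ≠ 0 := (Fact.out : p.Prime).ne_zero
  haveI : NeZero p := ⟨hp⟩
  let χ : AddChar G₁ ℂ := (AddChar.zmodChar p hω.pow_eq_one).compAddMonoidHom l.toAddMonoidHom
  have h1 : ∀ x, χ x = ω ^ (l x).val := fun x => rfl
  have := AddChar.sum_eq_ite χ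
  simp only [h1] at this
  rw [this]
  have : χ = 0 ↔ l = 0 := by
    constructor
    · intro h
      ext x
      have hx : χ x = 1 := by rw [h]; rfl
      rw [h1] at hx
      have := hω.dvd_of_pow_eq_one _ hx
      have h2 := Nat.eq_zero_of_dvd_of_lt this (ZMod.val_lt _)
      simpa using h2
    · intro h
      ext x
      rw [h1, h]; simp
  simp [this]

open Classical in
lemma ker_card {d r : ℕ} (ω : ℂ) (hω : IsPrimitiveRoot ω p)
    (β : G₁ →ₗ[ZMod p] G₂ →ₗ[ZMod p] (Fin d → ZMod p))
    (hbias : ∀ lam : Fin d → ZMod p, lam ≠ 0 →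
      ‖(∑ x : G₁, ∑ y : G₂, ω ^ (∑ i, lam i * β x y i).val)
          / ((Fintype.card G₁ : ℂ) * (Fintype.card G₂ : ℂ))‖
        ≤ (p : ℝ) ^ (-(r : ℤ)))
    (ψ : Dual (ZMod p) (Fin d → ZMod p)) (hψ : ψ ≠ 0) :
    (Finset.univ.filter fun z : G₂ => ∀ x, ψ (β x z) = 0).card * p ^ r ≤ Fintype.card G₂ := by
  have hp : 0 < (p : ℝ) := by exact_mod_cast (Fact.out : p.Prime).pos
  let lam : Fin d → ZMod p := fun i => ψ (Pi.single i 1)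
  have hlam : ∀ t, ψ t = ∑ i, lam i * t i := by
    intro t
    conv_lhs => rw [pi_eq_sum_univ' t]
    simp [lam, map_sum, mul_comm, Pi.single_apply, Pi.single]
    try rfl
  have h0 : lam ≠ 0 := fun h => hψ (by ext i; simpa using congrFun h i)
  have h := hbias lam h0
  have hsum : (∑ x : G₁, ∑ y : G₂, ω ^ (∑ i, lam i * β x y i).val)
      = (Fintype.card G₁ : ℂ) * ((Finset.univ.filter fun z : G₂ => ∀ x, ψ (β x z) = 0).card : ℂ) := by
    rw [Finset.sum_comm]
    have : ∀ y : G₂, ∑ x : G₁, ω ^ (∑ i, lam i * β x y i).val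
        = if ∀ x, ψ (β x y) = 0 then (Fintype.card G₁ : ℂ) else 0 := by
      intro y
      have := char_sum ω hω (ψ ∘ₗ β.flip y)
      simp only [LinearMap.comp_apply, LinearMap.flip_apply, hlam] at this
      rw [this]
      congr 1
      simp [LinearMap.ext_iff, hlam]
    simp only [this]
    rw [Finset.sum_ite]
    simp [mul_comm]
  rw [hsum] at h
  have hc1 : (Fintype.card G₁ : ℂ) ≠ 0 := by exact_mod_cast Fintype.card_ne_zero
  have hc2 : (0 : ℝ) < (Fintype.card G₂ : ℝ) := by exact_mod_cast Fintype.card_pos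
  rw [mul_div_mul_left _ _ hc1, norm_div, Complex.norm_natCast, Complex.norm_natCast,
    zpow_neg, zpow_natCast, div_le_iff₀ hc2, inv_mul_eq_div, le_div_iff₀ (by positivity)] at h
  exact_mod_cast h

open Classical in
lemma bad_card {d r : ℕ} (β : G₁ →ₗ[ZMod p] G₂ →ₗ[ZMod p] (Fin d → ZMod p))
    (hk : ∀ ψ : Dual (ZMod p) (Fin d → ZMod p), ψ ≠ 0 →
      (Finset.univ.filter fun z : G₂ => ∀ x, ψ (β x z) = 0).card * p ^ r ≤ Fintype.card G₂)
    (f : G₁ →ₗ[ZMod p] (Fin d → ZMod p) × (Fin d → ZMod p)) (c : G₂) :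
    (Finset.univ.filter fun z : G₂ => Bad f (β.flip (z - c))).card * p ^ r
      ≤ p ^ (3 * d) * Fintype.card G₂ := by
  haveI : Finite (Dual (ZMod p) (Fin d → ZMod p)) := Module.finite_of_finite (ZMod p)
  haveI : Finite (Dual (ZMod p) ((Fin d → ZMod p) × (Fin d → ZMod p))) :=
    Module.finite_of_finite (ZMod p)
  haveI := Fintype.ofFinite (Dual (ZMod p) (Fin d → ZMod p))
  haveI := Fintype.ofFinite (Dual (ZMod p) ((Fin d → ZMod p) × (Fin d → ZMod p)))
  let I := Dual (ZMod p) (Fin d → ZMod p) × Dual (ZMod p) ((Fin d → ZMod p) × (Fin d → ZMod p))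
  let S : I → Finset G₂ := fun q =>
    if q.1 = 0 then ∅ else Finset.univ.filter fun z : G₂ => ∀ x, q.1 (β x (z - c)) = q.2 (f x)
  have hsub : (Finset.univ.filter fun z : G₂ => Bad f (β.flip (z - c)))
      ⊆ (Finset.univ : Finset I).biUnion S := by
    intro z hz
    obtain ⟨ψ, h0, χ, hx⟩ := (Finset.mem_filter.1 hz).2
    refine Finset.mem_biUnion.2 ⟨(ψ, χ), Finset.mem_univ _, ?_⟩
    simp only [S, if_neg h0, Finset.mem_filter, Finset.mem_univ, true_and]
    exact hx
  have hS : ∀ q, (S q).card * p ^ r ≤ Fintype.card G₂ := by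
    intro q
    by_cases h0 : q.1 = 0
    · simp [S, h0]
    · refine le_trans (Nat.mul_le_mul_right _ ?_) (hk q.1 h0)
      rcases (S q).eq_empty_or_nonempty with he | ⟨z0, hz0⟩
      · simp [he]
      · simp only [S, if_neg h0, Finset.mem_filter, Finset.mem_univ, true_and] at hz0
        refine Finset.card_le_card_of_injOn (fun z => z - z0) ?_ (sub_left_injective.injOn)
        intro z hz
        simp only [S, if_neg h0, Finset.coe_filter, Set.mem_setOf_eq, Finset.mem_univ, true_and] at hz ⊢
        intro x
        have h1 := hz x
        have h2 := hz0 x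
        rw [show z - z0 = (z - c) - (z0 - c) by abel, map_sub, map_sub, h1, h2, sub_self]
  have hI : Fintype.card I = p ^ (3 * d) := by
    rw [Module.card_eq_pow_finrank (K := ZMod p) (V := I), ZMod.card]
    congr 1
    simp only [I, Module.finrank_prod, Subspace.dual_finrank_eq, Module.finrank_fin_fun]
    ring
  calc _ ≤ (∑ q : I, (S q).card) * p ^ r :=
        Nat.mul_le_mul_right _ ((Finset.card_le_card hsub).trans Finset.card_biUnion_le)
    _ = ∑ q : I, (S q).card * p ^ r := Finset.sum_mul _ _ _
    _ ≤ ∑ q : I, Fintype.card G₂ := Finset.sum_le_sum fun q _ => hS q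
    _ = _ := by rw [Finset.sum_const, Finset.card_univ, hI, smul_eq_mul]

open Classical in
lemma supply {d r : ℕ} (hr : 20 * d ≤ r) (β : G₁ →ₗ[ZMod p] G₂ →ₗ[ZMod p] (Fin d → ZMod p))
    (hk : ∀ ψ : Dual (ZMod p) (Fin d → ZMod p), ψ ≠ 0 →
      (Finset.univ.filter fun z : G₂ => ∀ x, ψ (β x z) = 0).card * p ^ r ≤ Fintype.card G₂) :
    Supply β := by
  intro x f c
  rcases Nat.eq_zero_or_pos d with rfl | hd
  · refine ⟨0, Subsingleton.elim _ _, fun i => ?_⟩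
    rintro ⟨ψ, h0, -⟩
    exact h0 (Subsingleton.elim _ _)
  by_contra! hcon
  have hp2 : 2 ≤ p := (Fact.out : p.Prime).two_le
  let K : Finset G₂ := Finset.univ.filter fun z => β x z = 0
  have hK : Fintype.card G₂ ≤ p ^ d * K.card := by
    have h1 := Submodule.card_eq_card_quotient_mul_card (LinearMap.ker (β x))
    rw [Nat.card_congr (LinearMap.quotKerEquivRange (β x)).toEquiv] at h1
    have h2 : Nat.card (LinearMap.range (β x)) ≤ p ^ d := by
      have := Nat.card_le_card_of_injective (Subtype.val : LinearMap.range (β x) → (Fin d → ZMod p))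
        Subtype.val_injective
      simpa using this
    have h3 : Nat.card (LinearMap.ker (β x)) = K.card := by
      rw [Nat.card_eq_fintype_card, Fintype.card_subtype]
      simp [K]
    rw [Nat.card_eq_fintype_card, h3] at h1
    first
    | (rw [h1]; exact Nat.mul_le_mul_right _ h2)
    | (rw [h1, mul_comm]; exact Nat.mul_le_mul_right _ h2)
  have hsub : K ⊆ (Finset.univ : Finset (Fin 4)).biUnion fun i =>
      Finset.univ.filter fun z : G₂ => Bad (f i) (β.flip (z - c i)) := by
    intro z hz
    obtain ⟨i, hi⟩ := hcon z (Finset.mem_filter.1 hz).2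
    exact Finset.mem_biUnion.2 ⟨i, Finset.mem_univ _, by simpa using hi⟩
  have h4 : K.card * p ^ r ≤ 4 * (p ^ (3 * d) * Fintype.card G₂) := by
    calc _ ≤ (∑ i : Fin 4, (Finset.univ.filter fun z : G₂ => Bad (f i) (β.flip (z - c i))).card) * p ^ r :=
          Nat.mul_le_mul_right _ ((Finset.card_le_card hsub).trans Finset.card_biUnion_le)
      _ = ∑ i : Fin 4, (Finset.univ.filter fun z : G₂ => Bad (f i) (β.flip (z - c i))).card * p ^ r :=
          Finset.sum_mul _ _ _
      _ ≤ ∑ i : Fin 4, p ^ (3 * d) * Fintype.card G₂ :=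
          Finset.sum_le_sum fun i _ => bad_card β hk (f i) (c i)
      _ = _ := by simp
  have hG : 0 < Fintype.card G₂ := Fintype.card_pos
  have h5 : Fintype.card G₂ * p ^ r ≤ Fintype.card G₂ * (4 * p ^ (4 * d)) := by
    calc _ ≤ (p ^ d * K.card) * p ^ r := Nat.mul_le_mul_right _ hK
      _ = p ^ d * (K.card * p ^ r) := by ring
      _ ≤ p ^ d * (4 * (p ^ (3 * d) * Fintype.card G₂)) := Nat.mul_le_mul_left _ h4
      _ = _ := by ring
  have h6 := Nat.le_of_mul_le_mul_left h5 hG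
  have h7 : 4 * p ^ (4 * d) < p ^ r := by
    calc 4 * p ^ (4 * d) < 2 ^ 3 * p ^ (4 * d) := by
          have : 0 < p ^ (4 * d) := by positivity
          omega
      _ ≤ p ^ 3 * p ^ (4 * d) := Nat.mul_le_mul_right _ (Nat.pow_le_pow_left hp2 3)
      _ = p ^ (3 + 4 * d) := by rw [pow_add]
      _ ≤ p ^ r := Nat.pow_le_pow_right (by omega) (by omega)
  omega

end count

end HRB

/-- **high-rank bilinear extension.** If `β : G₁ × G₂ → 𝔽_p^d` is bilinear
with `|E_{x,y} ω^{λ·β(x,y)}| ≤ p^{-r}` for all nonzero `λ`, where `r ≥ 20d`, and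
`φ : D → H` is bilinear on `D = {β = 0}`, then `φ` extends to a globally bilinear map
`Φ : G₁ × G₂ → H` agreeing with `φ` on all of `D`. -/
theorem high_rank_bilinear_extension (p : ℕ) [Fact p.Prime]
    {G₁ G₂ H : Type*}
    [AddCommGroup G₁] [Module (ZMod p) G₁] [AddCommGroup G₂] [Module (ZMod p) G₂]
    [AddCommGroup H] [Module (ZMod p) H]
    [Fintype G₁] [Fintype G₂] [Module.Finite (ZMod p) H]
    (d r : ℕ) (hr : 20 * d ≤ r)
    (β : G₁ →ₗ[ZMod p] G₂ →ₗ[ZMod p] (Fin d → ZMod p))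
    (ω : ℂ) (hω : ω = Complex.exp (2 * Real.pi * Complex.I / p))
    (hbias : ∀ lam : Fin d → ZMod p, lam ≠ 0 →
      ‖(∑ x : G₁, ∑ y : G₂, ω ^ (∑ i, lam i * β x y i).val)
          / ((Fintype.card G₁ : ℂ) * (Fintype.card G₂ : ℂ))‖
        ≤ (p : ℝ) ^ (-(r : ℤ)))
    (D : Set (G₁ × G₂)) (hD : D = {q | β q.1 q.2 = 0})
    (φ : G₁ → G₂ → H) (hφ : BilinearOnSet (F := ZMod p) D φ) :
    ∃ Φ : G₁ →ₗ[ZMod p] G₂ →ₗ[ZMod p] H, ∀ q ∈ D, Φ q.1 q.2 = φ q.1 q.2 := by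
  have hω' : IsPrimitiveRoot ω p := by
    rw [hω]
    exact Complex.isPrimitiveRoot_exp p (Fact.out : p.Prime).ne_zero
  have hS := HRB.supply hr β (fun ψ hψ => HRB.ker_card ω hω' β hbias ψ hψ)
  subst hD
  obtain ⟨h1, h2, h3, h4⟩ := hφ
  simp only [Set.mem_setOf_eq] at h1 h2 h3 h4
  have hLex : ∀ y, ∃ l : G₁ →ₗ[ZMod p] H, ∀ x, β x y = 0 → l x = φ x y := by
    intro y
    let l0 : LinearMap.ker (β.flip y) →ₗ[ZMod p] H :=
      { toFun := fun x => φ x y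
        map_add' := fun x x' => h3 _ _ _ x.2 x'.2
        map_smul' := fun c x => h4 _ _ _ x.2 }
    obtain ⟨l, hl⟩ := LinearMap.exists_extend l0
    exact ⟨l, fun x hx => LinearMap.congr_fun hl ⟨x, hx⟩⟩
  choose L hL using hLex
  obtain ⟨Φ, hΦ⟩ := HRB.main_of_supply β hS L (fun x y y' hy hy' => by
    rw [hL _ _ hy, hL _ _ hy', hL _ _ (by rw [map_add, hy, hy', add_zero]), h1 x y y' hy hy'])
  exact ⟨Φ, fun q hq => by rw [hΦ _ _ hq, hL _ _ hq]⟩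
end
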